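/- Let α, β be real numbers with α ≥ β > -1 and α ≥ -1/2. Then for every f ∈ L_{(α,β)}, the Fourier–Jacobi coefficients tend to zero: lim_{k→∞} f̂_{(α,β)}(k) = 0. -/

import Mathlib

open MeasureTheory Filter Set

noncomputable section

/-- Generalized binomial coefficient `C(a, m) = Γ(a+1)/(Γ(m+1)Γ(a-m+1))`. -/
def genBinom (a : ℝ) (m : ℕ) : ℝ :=
  Real.Gamma (a + 1) / (Real.Gamma ((m : ℝ) + 1) * Real.Gamma (a - (m : ℝ) + 1))

/-- The Jacobi polynomial `P_k^{(α,β)}(x)`. -/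
def jacobiP (α β : ℝ) (k : ℕ) (x : ℝ) : ℝ :=
  ∑ s ∈ Finset.range (k + 1),
    genBinom ((k : ℝ) + α) (k - s) * genBinom ((k : ℝ) + β) s *
      ((x - 1) / 2) ^ s * ((x + 1) / 2) ^ (k - s)

/-- The normalized Jacobi polynomial `R_k^{(α,β)}(x) = P_k^{(α,β)}(x)/P_k^{(α,β)}(1)`. -/
def jacobiR (α β : ℝ) (k : ℕ) (x : ℝ) : ℝ := jacobiP α β k x / jacobiP α β k 1

/-- The Jacobi weight `(sin(θ/2))^{2α+1} (cos(θ/2))^{2β+1}`. -/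
def jacobiWeight (α β : ℝ) (θ : ℝ) : ℝ :=
  Real.sin (θ / 2) ^ (2 * α + 1) * Real.cos (θ / 2) ^ (2 * β + 1)

/-- `f ∈ L_{(α,β)}`: `f` is integrable on `[0,π]` against the Jacobi weight. -/
def MemJacobiL (α β : ℝ) (f : ℝ → ℝ) : Prop :=
  IntegrableOn (fun θ => f θ * jacobiWeight α β θ) (Ioc 0 Real.pi)

/-- The norm `‖f‖_{L_{(α,β)}}`. -/
def jacobiNorm (α β : ℝ) (f : ℝ → ℝ) : ℝ :=
  ∫ θ in Ioc (0 : ℝ) Real.pi, |f θ| * jacobiWeight α β θ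

/-- The `k`-th Fourier–Jacobi coefficient `f̂_{(α,β)}(k)`. -/
def fourierJacobi (α β : ℝ) (f : ℝ → ℝ) (k : ℕ) : ℝ :=
  ∫ θ in Ioc (0 : ℝ) Real.pi, f θ * jacobiR α β k (Real.cos θ) * jacobiWeight α β θ

end

open Polynomial in
/-- The Jacobi polynomial as an element of `ℝ[X]`. -/
noncomputable def jacobiPoly (α β : ℝ) (k : ℕ) : ℝ[X] :=
  ∑ s ∈ Finset.range (k + 1), C (genBinom ((k : ℝ) + α) (k - s) * genBinom ((k : ℝ) + β) s) *
    ((C (1 / 2) * (X - 1)) ^ s * (C (1 / 2) * (X + 1)) ^ (k - s))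

open Polynomial in
/-- The Jacobi differential operator `(1 - x²) y'' + (β - α - (α + β + 2) x) y' + l y`. -/
noncomputable def jacobiOp (α β l : ℝ) (p : ℝ[X]) (x : ℝ) : ℝ :=
  (1 - x ^ 2) * p.derivative.derivative.eval x
    + (β - α - (α + β + 2) * x) * p.derivative.eval x + l * p.eval x

lemma eval_jacobiPoly (α β : ℝ) (k : ℕ) (x : ℝ) :
    (jacobiPoly α β k).eval x = jacobiP α β k x := by
  simp only [jacobiPoly, jacobiP, Polynomial.eval_finsetSum]
  refine Finset.sum_congr rfl fun s _ => ?_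
  simp only [Polynomial.eval_mul, Polynomial.eval_C, Polynomial.eval_pow, Polynomial.eval_sub,
    Polynomial.eval_add, Polynomial.eval_X, Polynomial.eval_one]
  ring

open Polynomial in
lemma jacobiOp_sum (α β l : ℝ) {ι : Type*} (S : Finset ι) (c : ι → ℝ) (p : ι → ℝ[X]) (x : ℝ) :
    jacobiOp α β l (∑ s ∈ S, C (c s) * p s) x = ∑ s ∈ S, c s * jacobiOp α β l (p s) x := by
  simp only [jacobiOp, derivative_sum, derivative_C_mul, eval_finsetSum, eval_mul, eval_C,
    Finset.mul_sum, ← Finset.sum_add_distrib]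
  exact Finset.sum_congr rfl fun s _ => by ring

open Polynomial in
lemma jacobiOp_monomial (α β : ℝ) (s n : ℕ) (x : ℝ) :
    jacobiOp α β (((s : ℝ) + n) * (s + n + α + β + 1))
      ((C (1 / 2) * (X - 1)) ^ s * (C (1 / 2) * (X + 1)) ^ n) x =
    (s * (s + α) + n * (n + β)) * (((x - 1) / 2) ^ s * ((x + 1) / 2) ^ n)
      - s * (s + α) * (((x - 1) / 2) ^ (s - 1) * ((x + 1) / 2) ^ (n + 1))
      - n * (n + β) * (((x - 1) / 2) ^ (s + 1) * ((x + 1) / 2) ^ (n - 1)) := by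
  have hA : eval x (C (1 / 2) * (X - 1) : ℝ[X]) = (x - 1) / 2 := by simp; ring
  have hB : eval x (C (1 / 2) * (X + 1) : ℝ[X]) = (x + 1) / 2 := by simp; ring
  have hA' : derivative (C (1 / 2) * (X - 1) : ℝ[X]) = C (1 / 2) := by simp
  have hB' : derivative (C (1 / 2) * (X + 1) : ℝ[X]) = C (1 / 2) := by simp
  generalize (C (1 / 2) * (X - 1) : ℝ[X]) = A at *
  generalize (C (1 / 2) * (X + 1) : ℝ[X]) = B at *
  rcases s with _ | _ | s <;> rcases n with _ | _ | n <;>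
    simp only [jacobiOp, derivative_mul, derivative_pow, derivative_add, derivative_C,
      derivative_one, derivative_zero, hA', hB', eval_mul, eval_add, eval_pow, eval_C, eval_one,
      eval_zero, hA, hB, pow_zero, Nat.add_sub_cancel, Nat.zero_add, Nat.zero_sub] <;>
    push_cast <;> ring

lemma genBinom_mul_succ {α β : ℝ} (hα : -1 < α) (hβ : -1 < β) {k s : ℕ} (hs : s < k) :
    ((s : ℝ) + 1) * (s + 1 + α) *
        (genBinom ((k : ℝ) + α) (k - (s + 1)) * genBinom ((k : ℝ) + β) (s + 1)) =
      (k - s : ℕ) * ((k - s : ℕ) + β) *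
        (genBinom ((k : ℝ) + α) (k - s) * genBinom ((k : ℝ) + β) s) := by
  obtain ⟨n, rfl⟩ : ∃ n, k = s + n + 1 := ⟨k - s - 1, by omega⟩
  have h1 : s + n + 1 - (s + 1) = n := by omega
  have h2 : s + n + 1 - s = n + 1 := by omega
  rw [h1, h2]
  unfold genBinom
  have hs0 : (0 : ℝ) ≤ s := s.cast_nonneg
  have hn0 : (0 : ℝ) ≤ n := n.cast_nonneg
  push_cast
  rw [show (s : ℝ) + n + 1 + α - n + 1 = (s + α + 1) + 1 by ring,
    show (s : ℝ) + n + 1 + β - (s + 1) + 1 = n + β + 1 by ring,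
    show (s : ℝ) + n + 1 + α - (n + 1) + 1 = s + α + 1 by ring,
    show (s : ℝ) + n + 1 + β - s + 1 = (n + β + 1) + 1 by ring,
    Real.Gamma_add_one (s := (s : ℝ) + α + 1) (by linarith),
    Real.Gamma_add_one (s := (n : ℝ) + β + 1) (by linarith),
    Real.Gamma_add_one (s := (s : ℝ) + 1) (by linarith),
    Real.Gamma_add_one (s := (n : ℝ) + 1) (by linarith)]
  have g1 := (Real.Gamma_pos_of_pos (show 0 < (s : ℝ) + α + 1 by linarith)).ne'
  have g2 := (Real.Gamma_pos_of_pos (show 0 < (n : ℝ) + β + 1 by linarith)).ne'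
  have g3 := (Real.Gamma_pos_of_pos (show 0 < (s : ℝ) + 1 by linarith)).ne'
  have g4 := (Real.Gamma_pos_of_pos (show 0 < (n : ℝ) + 1 by linarith)).ne'
  have g5 : (s : ℝ) + α + 1 ≠ 0 := by linarith
  have g6 : (n : ℝ) + β + 1 ≠ 0 := by linarith
  have g7 : (s : ℝ) + 1 ≠ 0 := by linarith
  have g8 : (n : ℝ) + 1 ≠ 0 := by linarith
  field_simp
  ring

/-- The Jacobi differential equation. -/
lemma jacobiOp_jacobiPoly {α β : ℝ} (hα : -1 < α) (hβ : -1 < β) (k : ℕ) (x : ℝ) :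
    jacobiOp α β (k * (k + α + β + 1)) (jacobiPoly α β k) x = 0 := by
  rw [jacobiPoly, jacobiOp_sum]
  set c : ℕ → ℝ := fun s => genBinom ((k : ℝ) + α) (k - s) * genBinom ((k : ℝ) + β) s with hc
  set T : ℕ → ℝ := fun s => ((x - 1) / 2) ^ s * ((x + 1) / 2) ^ (k - s) with hT
  have key : ∀ s ∈ Finset.range (k + 1),
      c s * jacobiOp α β (k * (k + α + β + 1)) ((Polynomial.C (1 / 2) * (Polynomial.X - 1)) ^ s *
        (Polynomial.C (1 / 2) * (Polynomial.X + 1)) ^ (k - s)) x =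
      c s * (s * (s + α)) * (T s - T (s - 1))
        + c s * ((k - s : ℕ) * ((k - s : ℕ) + β)) * (T s - T (s + 1)) := by
    intro s hs
    have hsk : s ≤ k := by simpa [Nat.lt_succ_iff] using hs
    have := jacobiOp_monomial α β s (k - s) x
    have hk : (s : ℝ) + (k - s : ℕ) = k := by rw [Nat.cast_sub hsk]; ring
    rw [hk] at this
    rw [this]
    have h2 : T (s + 1) = ((x - 1) / 2) ^ (s + 1) * ((x + 1) / 2) ^ (k - s - 1) := by
      simp only [hT, Nat.sub_sub]
    rw [h2]
    rcases s with _ | s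
    · simp [hT]; ring
    · have h3 : k - s = k - (s + 1) + 1 := by omega
      simp only [hT, Nat.add_sub_cancel, ← h3]
      ring
  rw [Finset.sum_congr rfl key, Finset.sum_add_distrib, Finset.sum_range_succ',
    Finset.sum_range_succ (fun s => c s * ((k - s : ℕ) * ((k - s : ℕ) + β)) * (T s - T (s + 1)))]
  simp only [Nat.sub_self, Nat.cast_zero, zero_mul, mul_zero, add_zero, ← Finset.sum_add_distrib,
    Nat.add_sub_cancel]
  refine Finset.sum_eq_zero fun s hs => ?_
  have := genBinom_mul_succ hα hβ (Finset.mem_range.1 hs)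
  simp only [hc]
  push_cast
  linear_combination (T (s + 1) - T s) * this

lemma genBinom_zero_right {a : ℝ} (ha : -1 < a) : genBinom a 0 = 1 := by
  have := (Real.Gamma_pos_of_pos (show 0 < a + 1 by linarith)).ne'
  simp [genBinom, this]

lemma jacobiP_one (α : ℝ) {β : ℝ} (hβ : -1 < β) (k : ℕ) :
    jacobiP α β k 1 = genBinom (k + α) k := by
  have hk : (0 : ℝ) ≤ k := k.cast_nonneg
  rw [jacobiP, Finset.sum_eq_single 0]
  · simp [genBinom_zero_right (show -1 < (k : ℝ) + β by linarith)]
  · intro s _ hs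
    simp [hs]
  · simp

lemma jacobiP_neg_one {α : ℝ} (hα : -1 < α) (β : ℝ) (k : ℕ) :
    jacobiP α β k (-1) = (-1) ^ k * genBinom (k + β) k := by
  have hk : (0 : ℝ) ≤ k := k.cast_nonneg
  rw [jacobiP, Finset.sum_eq_single k]
  · norm_num [genBinom_zero_right (show -1 < (k : ℝ) + α by linarith)]
    ring
  · intro s hs hsk
    have : k - s ≠ 0 := by have := Finset.mem_range.1 hs; omega
    simp [this]
  · simp

lemma genBinom_add_self_succ {α : ℝ} (hα : -1 < α) (k : ℕ) :
    genBinom ((k + 1 : ℕ) + α) (k + 1) = (k + 1 + α) / (k + 1) * genBinom (k + α) k := by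
  have hk : (0 : ℝ) ≤ k := k.cast_nonneg
  unfold genBinom
  push_cast
  rw [show (k : ℝ) + 1 + α + 1 = (k + α + 1) + 1 by ring,
    Real.Gamma_add_one (s := (k : ℝ) + α + 1) (by linarith),
    Real.Gamma_add_one (s := (k : ℝ) + 1) (by linarith),
    show (k : ℝ) + 1 + α - (k + 1) + 1 = α + 1 by ring,
    show (k : ℝ) + α - k + 1 = α + 1 by ring]
  have g1 := (Real.Gamma_pos_of_pos (show 0 < α + 1 by linarith)).ne'
  have g2 := (Real.Gamma_pos_of_pos (show 0 < (k : ℝ) + 1 by linarith)).ne'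
  field_simp
  ring

lemma genBinom_add_self_pos {α : ℝ} (hα : -1 < α) (k : ℕ) : 0 < genBinom (k + α) k := by
  induction k with
  | zero => simp [genBinom_zero_right hα]
  | succ k ih =>
    rw [genBinom_add_self_succ hα]
    have hk : (0 : ℝ) ≤ k := k.cast_nonneg
    exact mul_pos (div_pos (by linarith) (by linarith)) ih

lemma genBinom_add_self_mono {α β : ℝ} (hβ : -1 < β) (h : β ≤ α) (k : ℕ) :
    genBinom (k + β) k ≤ genBinom (k + α) k := by
  have hα : -1 < α := hβ.trans_le h
  induction k with
  | zero => simp [genBinom_zero_right hα, genBinom_zero_right hβ]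
  | succ k ih =>
    rw [genBinom_add_self_succ hα, genBinom_add_self_succ hβ]
    have hk : (0 : ℝ) ≤ k := k.cast_nonneg
    have := (genBinom_add_self_pos hβ k).le
    have : 0 ≤ ((k : ℝ) + 1 + α) / (k + 1) := div_nonneg (by linarith) (by linarith)
    gcongr

open Polynomial in
/-- Bound by the endpoint values, via the monotonicity of Sonin's function
`y² + (1 - x²) y'² / l`. -/
lemma sonin_le {α β l : ℝ} (hα : -(1 / 2) ≤ α) (hl : 0 < l) {p : ℝ[X]}
    (hp : ∀ x, jacobiOp α β l p x = 0) (hends : p.eval (-1) ^ 2 ≤ p.eval 1 ^ 2)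
    {x : ℝ} (hx : x ∈ Icc (-1 : ℝ) 1) :
    p.eval x ^ 2 + (1 - x ^ 2) / l * p.derivative.eval x ^ 2 ≤ p.eval 1 ^ 2 := by
  set S : ℝ → ℝ := fun x => p.eval x ^ 2 + (1 - x ^ 2) / l * p.derivative.eval x ^ 2 with hS
  have hd : ∀ x, HasDerivAt S
      (2 * p.derivative.eval x ^ 2 / l * (α - β + (α + β + 1) * x)) x := by
    intro x
    have h := ((p.hasDerivAt x).pow 2).add
      ((((hasDerivAt_id x).pow 2).const_sub 1 |>.div_const l).mul
        ((p.derivative.hasDerivAt x).pow 2))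
    refine h.congr_deriv ?_
    have := hp x
    simp only [jacobiOp] at this
    simp only [Nat.cast_ofNat, id, Nat.add_one_sub_one, pow_one, mul_one, Pi.pow_apply]
    field_simp
    linear_combination p.derivative.eval x * this
  have hc : Continuous S := by
    rw [continuous_iff_continuousAt]; exact fun x => (hd x).continuousAt
  have h1 : S 1 = p.eval 1 ^ 2 := by simp [hS]
  have hm1 : S (-1) = p.eval (-1) ^ 2 := by simp [hS]
  have hmono : ∀ a b : ℝ, a ≤ b → (∀ y ∈ Ioo a b, 0 ≤ α - β + (α + β + 1) * y) → S a ≤ S b := by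
    intro a b hab h
    refine monotoneOn_of_deriv_nonneg (convex_Icc a b) hc.continuousOn
      (fun y _ => (hd y).differentiableAt.differentiableWithinAt) (fun y hy => ?_)
      (left_mem_Icc.2 hab) (right_mem_Icc.2 hab) hab
    rw [(hd y).deriv]
    rw [interior_Icc] at hy
    exact mul_nonneg (by positivity) (h y hy)
  have hanti : ∀ a b : ℝ, a ≤ b → (∀ y ∈ Ioo a b, α - β + (α + β + 1) * y ≤ 0) → S b ≤ S a := by
    intro a b hab h
    refine antitoneOn_of_deriv_nonpos (convex_Icc a b) hc.continuousOn
      (fun y _ => (hd y).differentiableAt.differentiableWithinAt) (fun y hy => ?_)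
      (left_mem_Icc.2 hab) (right_mem_Icc.2 hab) hab
    rw [(hd y).deriv]
    rw [interior_Icc] at hy
    exact mul_nonpos_of_nonneg_of_nonpos (by positivity) (h y hy)
  change S x ≤ _
  by_cases hx0 : 0 ≤ α - β + (α + β + 1) * x
  · rw [← h1]
    refine hmono x 1 hx.2 fun y hy => ?_
    nlinarith [hy.1, hy.2, hx.1]
  · push Not at hx0
    refine le_trans ?_ (hm1 ▸ hends)
    refine hanti (-1) x hx.1 fun y hy => ?_
    have : 0 < α + β + 1 := by
      by_contra! h
      nlinarith [hx.2]
    nlinarith [hy.2]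

open Polynomial in
/-- Oscillation estimate for solutions of the Jacobi equation against `g(θ) sin θ`. -/
lemma exists_abs_integral_le (α β : ℝ) (g : ℝ[X]) :
    ∃ M : ℝ, ∀ (l : ℝ) (p : ℝ[X]), 0 < l → (∀ x, jacobiOp α β l p x = 0) →
      (∀ x ∈ Icc (-1 : ℝ) 1, (1 - x ^ 2) * p.derivative.eval x ^ 2 ≤ l) →
      |∫ θ in (0 : ℝ)..Real.pi, Real.sin θ * g.eval θ * p.eval (Real.cos θ)| ≤ M / √l := by
  set m : ℝ → ℝ := fun θ => g.derivative.eval θ * Real.sin θ + g.eval θ * Real.cos θ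
    - g.eval θ * (α - β + (α + β + 1) * Real.cos θ) with hm
  have hmc : Continuous m := by fun_prop
  obtain ⟨K, hK⟩ := (isCompact_Icc (a := (0 : ℝ)) (b := Real.pi)).exists_bound_of_continuousOn
    hmc.continuousOn
  refine ⟨K * Real.pi, fun l p hl hp hb => ?_⟩
  have hsl : 0 < √l := Real.sqrt_pos.2 hl
  set v : ℝ → ℝ := fun θ => -Real.sin θ * p.derivative.eval (Real.cos θ) with hv
  have hvc : Continuous v := by fun_prop
  have hv_le : ∀ θ, |v θ| ≤ √l := by
    intro θ
    refine Real.abs_le_sqrt ?_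
    have := hb (Real.cos θ) ⟨Real.neg_one_le_cos θ, Real.cos_le_one θ⟩
    rw [← Real.sin_sq] at this
    simpa [hv, mul_pow] using this
  have hd : ∀ θ, HasDerivAt (fun θ => g.eval θ * Real.sin θ * v θ)
      (m θ * v θ - l * (Real.sin θ * g.eval θ * p.eval (Real.cos θ))) θ := by
    intro θ
    have h1 := (g.hasDerivAt θ).mul (Real.hasDerivAt_sin θ)
    have h2 := (Real.hasDerivAt_sin θ).neg.mul
      ((p.derivative.hasDerivAt (Real.cos θ)).comp θ (Real.hasDerivAt_cos θ))
    refine (h1.mul h2).congr_deriv ?_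
    have h := hp (Real.cos θ)
    simp only [jacobiOp, ← Real.sin_sq] at h
    simp only [hm, hv, Function.comp, Pi.mul_apply, Pi.neg_apply]
    linear_combination (g.eval θ * Real.sin θ) * h
  have hint := intervalIntegral.integral_eq_sub_of_hasDerivAt (a := 0) (b := Real.pi)
    (fun θ _ => hd θ) (Continuous.intervalIntegrable (by fun_prop) _ _)
  rw [intervalIntegral.integral_sub (Continuous.intervalIntegrable (by fun_prop) _ _)
    (Continuous.intervalIntegrable (by fun_prop) _ _), intervalIntegral.integral_const_mul] at hint
  simp only [Real.sin_pi, Real.sin_zero, mul_zero, zero_mul, sub_zero] at hint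
  have hbound : |∫ θ in (0 : ℝ)..Real.pi, m θ * v θ| ≤ K * √l * |Real.pi - 0| := by
    rw [← Real.norm_eq_abs]
    refine intervalIntegral.norm_integral_le_of_norm_le_const fun θ hθ => ?_
    rw [uIoc_of_le Real.pi_pos.le] at hθ
    rw [norm_mul]
    exact mul_le_mul (hK θ (Ioc_subset_Icc_self hθ)) (hv_le θ) (norm_nonneg _)
      ((norm_nonneg _).trans (hK θ (Ioc_subset_Icc_self hθ)))
  rw [sub_zero, abs_of_pos Real.pi_pos] at hbound
  rw [sub_eq_zero.1 hint, abs_mul, abs_of_pos hl] at hbound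
  rw [le_div_iff₀ hsl]
  refine le_of_mul_le_mul_right ?_ hsl
  rw [mul_assoc, Real.mul_self_sqrt hl.le]
  linarith

open Polynomial in
/-- An integrable function on `(0, π]` is approximated in `L¹` by `sin θ` times polynomials. -/
lemma exists_polynomial_integral_sub_sin_mul_le {h : ℝ → ℝ}
    (hh : IntegrableOn h (Ioc 0 Real.pi)) {ε : ℝ} (hε : 0 < ε) :
    ∃ g : ℝ[X], ∫ θ in Ioc 0 Real.pi, |h θ - Real.sin θ * g.eval θ| ≤ ε := by
  set μ : Measure ℝ := volume.restrict (Ioc 0 Real.pi) with hμ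
  set w : ℝ → NNReal := fun θ => (Real.sin θ).toNNReal with hw
  have hwm : Measurable w := Real.measurable_sin.real_toNNReal
  have hw1 : ∀ θ, w θ ≤ 1 := fun θ => by
    simpa [hw, Real.toNNReal_le_one] using Real.sin_le_one θ
  have hwpos : ∀ᵐ θ ∂μ, 0 < Real.sin θ := by
    have h1 : ∀ᵐ θ ∂μ, θ ∈ Ioc 0 Real.pi := ae_restrict_mem measurableSet_Ioc
    have h2 : ∀ᵐ θ ∂μ, θ ≠ Real.pi := by
      rw [hμ]
      exact ae_restrict_of_ae (Measure.ae_ne volume Real.pi)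
    filter_upwards [h1, h2] with θ h1 h2
    exact Real.sin_pos_of_pos_of_lt_pi h1.1 (lt_of_le_of_ne h1.2 h2)
  set ν : Measure ℝ := μ.withDensity fun θ => w θ with hν
  have : IsFiniteMeasure ν := by
    refine isFiniteMeasure_withDensity (ne_of_lt ?_)
    calc ∫⁻ θ, (w θ : ENNReal) ∂μ ≤ ∫⁻ _, 1 ∂μ :=
          lintegral_mono fun θ => ENNReal.coe_le_one_iff.2 (hw1 θ)
      _ < ⊤ := by simp [hμ]
  have hint : Integrable (fun θ => h θ / Real.sin θ) ν := by
    rw [hν, integrable_withDensity_iff_integrable_smul hwm]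
    refine (show Integrable h μ from hh).congr ?_
    filter_upwards [hwpos] with θ hθ
    simp only [hw, NNReal.smul_def, Real.coe_toNNReal _ hθ.le, smul_eq_mul]
    field_simp
  obtain ⟨φ, -, hφ, hφc, -⟩ := hint.exists_hasCompactSupport_integral_sub_le (half_pos hε)
  rw [hν, integral_withDensity_eq_integral_smul hwm] at hφ
  have hφ' : ∫ θ, |h θ - Real.sin θ * φ θ| ∂μ ≤ ε / 2 := by
    refine le_trans (le_of_eq (integral_congr_ae ?_)) hφ
    filter_upwards [hwpos] with θ hθ
    simp only [hw, NNReal.smul_def, Real.coe_toNNReal _ hθ.le, smul_eq_mul, Real.norm_eq_abs]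
    nth_rw 2 [← abs_of_pos hθ]
    rw [← abs_mul]
    congr 1
    field_simp
  have hδ : 0 < ε / 2 / Real.pi := div_pos (half_pos hε) Real.pi_pos
  obtain ⟨g, hg⟩ := exists_polynomial_near_of_continuousOn 0 Real.pi φ hφc.continuousOn _ hδ
  refine ⟨g, ?_⟩
  have hcont : ∀ {F : ℝ → ℝ}, Continuous F → Integrable F μ := fun hF =>
    (hF.integrableOn_Icc (a := 0) (b := Real.pi)).mono_set Ioc_subset_Icc_self
  have hle : ∫ θ, |h θ - Real.sin θ * g.eval θ| ∂μ ≤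
      ∫ θ, (|h θ - Real.sin θ * φ θ| + ε / 2 / Real.pi) ∂μ := by
    refine integral_mono_ae (Integrable.abs (Integrable.sub hh (hcont (by fun_prop))))
      (Integrable.add (Integrable.abs (Integrable.sub hh (hcont (by fun_prop))))
        (integrable_const _)) ?_
    filter_upwards [ae_restrict_mem measurableSet_Ioc] with θ hθ
    have h1 := hg θ (Ioc_subset_Icc_self hθ)
    have h2 : |Real.sin θ * (φ θ - g.eval θ)| ≤ ε / 2 / Real.pi := by
      rw [abs_mul, abs_sub_comm]
      nlinarith [Real.abs_sin_le_one θ, abs_nonneg (g.eval θ - φ θ)]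
    calc |h θ - Real.sin θ * g.eval θ|
        = |(h θ - Real.sin θ * φ θ) + Real.sin θ * (φ θ - g.eval θ)| := by congr 1; ring
      _ ≤ _ := (abs_add_le _ _).trans (by gcongr)
  refine hle.trans ?_
  have hφi : Integrable (fun θ => |h θ - Real.sin θ * φ θ|) μ :=
    Integrable.abs (Integrable.sub hh (hcont (by fun_prop)))
  rw [integral_add hφi (integrable_const _), integral_const]
  have : μ.real univ = Real.pi := by simp [hμ, Measure.real, Real.pi_pos.le]
  rw [this, smul_eq_mul, mul_div_cancel₀ _ Real.pi_pos.ne']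
  linarith

/-- Boundedness plus decay against `sin θ` times polynomials gives decay against `L¹`. -/
lemma tendsto_integral_mul_of_polynomial {u : ℕ → ℝ → ℝ} (hu : ∀ k, Continuous (u k))
    (hu1 : ∀ᶠ k in atTop, ∀ θ, |u k θ| ≤ 1)
    (hpoly : ∀ g : Polynomial ℝ, Tendsto
      (fun k => ∫ θ in (0 : ℝ)..Real.pi, Real.sin θ * g.eval θ * u k θ) atTop (nhds 0))
    {h : ℝ → ℝ} (hh : IntegrableOn h (Ioc 0 Real.pi)) :
    Tendsto (fun k => ∫ θ in Ioc 0 Real.pi, h θ * u k θ) atTop (nhds 0) := by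
  rw [Metric.tendsto_nhds]
  intro ε hε
  obtain ⟨g, hg⟩ := exists_polynomial_integral_sub_sin_mul_le hh (half_pos hε)
  filter_upwards [hu1, Metric.tendsto_nhds.1 (hpoly g) _ (half_pos hε)] with k hk hgk
  rw [intervalIntegral.integral_of_le Real.pi_pos.le] at hgk
  rw [Real.dist_0_eq_abs] at hgk ⊢
  have hs : IntegrableOn (fun θ => Real.sin θ * g.eval θ) (Ioc 0 Real.pi) :=
    (Continuous.integrableOn_Icc (by fun_prop)).mono_set Ioc_subset_Icc_self
  have hmul : ∀ {F : ℝ → ℝ}, IntegrableOn F (Ioc 0 Real.pi) →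
      IntegrableOn (fun θ => F θ * u k θ) (Ioc 0 Real.pi) := fun hF =>
    Integrable.mul_bdd hF (hu k).aestronglyMeasurable
      (ae_of_all _ fun θ => (Real.norm_eq_abs _).trans_le (hk θ))
  have hd : IntegrableOn (fun θ => h θ - Real.sin θ * g.eval θ) (Ioc 0 Real.pi) := hh.sub hs
  have hsplit : ∫ θ in Ioc 0 Real.pi, h θ * u k θ =
      (∫ θ in Ioc 0 Real.pi, (h θ - Real.sin θ * g.eval θ) * u k θ) +
        ∫ θ in Ioc 0 Real.pi, Real.sin θ * g.eval θ * u k θ := by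
    rw [← integral_add (hmul hd) (hmul hs)]
    congr 1
    ext θ
    ring
  have hfirst : |∫ θ in Ioc 0 Real.pi, (h θ - Real.sin θ * g.eval θ) * u k θ| ≤ ε / 2 := by
    refine (abs_integral_le_integral_abs).trans (le_trans (integral_mono (hmul hd).abs hd.abs
      fun θ => ?_) hg)
    simp only [abs_mul]
    exact mul_le_of_le_one_right (abs_nonneg _) (hk θ)
  rw [hsplit]
  exact (abs_add_le _ _).trans_lt (by linarith)

/-- If `α ≥ β > -1` and `α ≥ -1/2`, then for every `f ∈ L_{(α,β)}` the
Fourier–Jacobi coefficients tend to zero. -/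
theorem riemann_lebesgue_jacobi (α β : ℝ) (hβα : β ≤ α) (hβ : -1 < β) (hα : -(1/2) ≤ α)
    (f : ℝ → ℝ) (hf : MemJacobiL α β f) :
    Tendsto (fun k : ℕ => fourierJacobi α β f k) atTop (nhds 0) := by
  have hα1 : -1 < α := by linarith
  set R : ℕ → Polynomial ℝ := fun k => Polynomial.C (jacobiP α β k 1)⁻¹ * jacobiPoly α β k with hR
  have hReval : ∀ k x, (R k).eval x = jacobiR α β k x := fun k x => by
    simp only [hR, Polynomial.eval_mul, Polynomial.eval_C, eval_jacobiPoly, jacobiR]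
    ring
  have hode : ∀ (k : ℕ) x, jacobiOp α β (k * (k + α + β + 1)) (R k) x = 0 := by
    intro k x
    have := jacobiOp_jacobiPoly hα1 hβ k x
    simp only [jacobiOp] at this
    simp only [jacobiOp, hR, Polynomial.derivative_C_mul, Polynomial.eval_mul, Polynomial.eval_C]
    linear_combination (jacobiP α β k 1)⁻¹ * this
  have hR1 : ∀ k, (R k).eval 1 = 1 := fun k => by
    rw [hReval, jacobiR, jacobiP_one α hβ]
    exact div_self (genBinom_add_self_pos hα1 k).ne'
  have hRm1 : ∀ k, (R k).eval (-1) ^ 2 ≤ (R k).eval 1 ^ 2 := by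
    intro k
    have h1 := genBinom_add_self_pos hα1 k
    have h2 := genBinom_add_self_pos hβ k
    rw [hR1, hReval, jacobiR, jacobiP_one α hβ, jacobiP_neg_one hα1, div_pow, mul_pow, ← pow_mul,
      mul_comm k 2, pow_mul, neg_one_sq, one_pow, one_pow, one_mul, div_le_one (by positivity)]
    exact pow_le_pow_left₀ h2.le (genBinom_add_self_mono hβ hβα k) 2
  have hl : ∀ k : ℕ, 1 ≤ k → 0 < (k : ℝ) * (k + α + β + 1) := by
    intro k hk
    have : (1 : ℝ) ≤ k := by exact_mod_cast hk
    exact mul_pos (by linarith) (by linarith)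
  have hsonin : ∀ k : ℕ, 1 ≤ k → ∀ x ∈ Icc (-1 : ℝ) 1, (R k).eval x ^ 2 +
      (1 - x ^ 2) / (k * (k + α + β + 1)) * (R k).derivative.eval x ^ 2 ≤ 1 := by
    intro k hk x hx
    have := sonin_le hα (hl k hk) (hode k) (hRm1 k) hx
    rwa [hR1, one_pow] at this
  have hltop : Tendsto (fun k : ℕ => √((k : ℝ) * (k + α + β + 1))) atTop atTop := by
    refine Real.tendsto_sqrt_atTop.comp (tendsto_natCast_atTop_atTop.atTop_mul_atTop₀ ?_)
    simp only [add_assoc]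
    exact tendsto_atTop_add_const_right _ _ tendsto_natCast_atTop_atTop
  have hmain : Tendsto (fun k => ∫ θ in Ioc 0 Real.pi,
      (f θ * jacobiWeight α β θ) * (R k).eval (Real.cos θ)) atTop (nhds 0) := by
    refine tendsto_integral_mul_of_polynomial (u := fun k θ => (R k).eval (Real.cos θ))
      (fun k => by fun_prop) ?_ ?_ hf
    · filter_upwards [eventually_ge_atTop 1] with k hk θ
      have hx : Real.cos θ ∈ Icc (-1 : ℝ) 1 := ⟨Real.neg_one_le_cos θ, Real.cos_le_one θ⟩
      have h := hsonin k hk _ hx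
      have : 0 ≤ (1 - Real.cos θ ^ 2) / (k * (k + α + β + 1)) *
          (R k).derivative.eval (Real.cos θ) ^ 2 :=
        mul_nonneg (div_nonneg (by nlinarith [hx.1, hx.2]) (hl k hk).le) (sq_nonneg _)
      exact (sq_le_one_iff_abs_le_one _).1 (by linarith)
    · intro g
      obtain ⟨M, hM⟩ := exists_abs_integral_le α β g
      refine squeeze_zero_norm' ?_ (hltop.const_div_atTop M)
      filter_upwards [eventually_ge_atTop 1] with k hk
      refine hM _ (R k) (hl k hk) (hode k) fun x hx => ?_
      have h := hsonin k hk x hx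
      rw [div_mul_eq_mul_div] at h
      exact (div_le_one (hl k hk)).1 (by nlinarith [sq_nonneg ((R k).eval x)])
  refine hmain.congr fun k => ?_
  unfold fourierJacobi
  congr 1
  ext θ
  rw [hReval]
  ring
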